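/- arXiv:2205.05726 — 2 statements merged into one kernel-verified Lean document; each statement's English description precedes it below -/
import Mathlib

section
/- Let G = (V, E) be a finite simple undirected graph and let e ∈ E be an edge. Then |Aut(G)| · |AO_{G−e}({e})| = |Aut(G − e)| · |AO_G({e})|, where G − e = (V, E ∖ {e}); equivalently, |Aut(G)| / |AO_G(e)| = |Aut(G − e)| / |AO_{G−e}(e)|. -/
/-- The set of automorphisms of a simple graph `G`: permutations `σ` of the
vertex set with `(a,b) ∈ E ↔ (σ a, σ b) ∈ E`. -/
def autSet {V : Type*} (G : SimpleGraph V) : Set (Equiv.Perm V) :=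
  {σ | ∀ a b : V, G.Adj a b ↔ G.Adj (σ a) (σ b)}

/-- The image of a set of unordered pairs under a permutation of the vertices. -/
def pairSetMap {V : Type*} (σ : Equiv.Perm V) (S : Set (Sym2 V)) : Set (Sym2 V) :=
  (Sym2.map σ) '' S

/-- The automorphism orbit of a set `S` of unordered vertex pairs in `G`:
`AO_G(S) = { σ(S) : σ ∈ Aut(G) }`. -/
def edgeSetOrbit {V : Type*} (G : SimpleGraph V) (S : Set (Sym2 V)) : Set (Set (Sym2 V)) :=
  {T | ∃ σ ∈ autSet G, pairSetMap σ S = T}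

/-- The automorphism orbit of a vertex `v` in `G`: `AO_G(v) = { σ v : σ ∈ Aut(G) }`. -/
def vertexOrbit {V : Type*} (G : SimpleGraph V) (v : V) : Set V :=
  {u | ∃ σ ∈ autSet G, σ v = u}

/-- `F` is an edge set on `V` forming a graph isomorphic to `G` (via a bijection of
the common vertex set carrying the edge set of `G` exactly onto `F`). -/
def isIsoEdgeSet {V : Type*} (G : SimpleGraph V) (F : Set (Sym2 V)) : Prop :=
  ∃ σ : Equiv.Perm V, pairSetMap σ G.edgeSet = F

/-- The automorphisms of `G` as a subgroup of the permutations of its vertices. -/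
def autSubgroup {V : Type*} (G : SimpleGraph V) : Subgroup (Equiv.Perm V) where
  carrier := autSet G
  mul_mem' hσ hτ a b := (hτ a b).trans (hσ _ _)
  one_mem' _ _ := Iff.rfl
  inv_mem' {σ} hσ a b := by simpa using (hσ (σ⁻¹ a) (σ⁻¹ b)).symm

/-- Permutations of the vertices act on sets of unordered pairs of vertices. -/
abbrev pairSetMulAction (V : Type*) : MulAction (Equiv.Perm V) (Set (Sym2 V)) where
  smul := pairSetMap
  one_smul S := by
    change Sym2.map id '' S = S
    rw [Sym2.map_id, Set.image_id]
  mul_smul σ τ S := by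
    change Sym2.map (σ ∘ τ) '' S = Sym2.map σ '' (Sym2.map τ '' S)
    rw [Sym2.map_comp, Set.image_comp]

/-- The orbit-stabilizer theorem for sets of vertex pairs. -/
theorem ncard_stabilizer_mul_ncard_edgeSetOrbit {V : Type*}
    (G : SimpleGraph V) (S : Set (Sym2 V)) :
    {σ ∈ autSet G | pairSetMap σ S = S}.ncard * (edgeSetOrbit G S).ncard =
      (autSet G).ncard := by
  let := pairSetMulAction V
  have horbit : MulAction.orbit (autSubgroup G) S = edgeSetOrbit G S := by
    ext T
    exact ⟨fun ⟨σ, h⟩ => ⟨σ, σ.2, h⟩, fun ⟨σ, hσ, h⟩ => ⟨⟨σ, hσ⟩, h⟩⟩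
  have hstab : Nat.card (MulAction.stabilizer (autSubgroup G) S) =
      {σ ∈ autSet G | pairSetMap σ S = S}.ncard :=
    Nat.card_congr
      { toFun := fun σ => ⟨σ.1.1, σ.1.2, σ.2⟩
        invFun := fun σ => ⟨⟨σ.1, σ.2.1⟩, σ.2.2⟩
        left_inv := fun _ => rfl
        right_inv := fun _ => rfl }
  rw [← hstab, ← horbit, ← MulAction.index_stabilizer]
  exact Subgroup.card_mul_index _

/-- A permutation fixing an edge `e` of `G` is an automorphism of `G - e` if and only if it is an
automorphism of `G`. -/
theorem mem_autSet_deleteEdges_iff {V : Type*} {G : SimpleGraph V} {e : Sym2 V}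
    (he : e ∈ G.edgeSet) {σ : Equiv.Perm V} (hσ : Sym2.map σ e = e) :
    σ ∈ autSet (G.deleteEdges {e}) ↔ σ ∈ autSet G := by
  refine forall₂_congr fun a b => ?_
  have hab : s(σ a, σ b) = e ↔ s(a, b) = e := by
    rw [← Sym2.map_mk, ← (Sym2.map.injective σ.injective).eq_iff (a := s(a, b)), hσ]
  simp only [SimpleGraph.deleteEdges_adj, Set.mem_singleton_iff, hab]
  by_cases h : s(a, b) = e
  · have h₁ : G.Adj a b := by rwa [← SimpleGraph.mem_edgeSet, h]
    have h₂ : G.Adj (σ a) (σ b) := by rwa [← SimpleGraph.mem_edgeSet, hab.2 h]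
    simp [h, h₁, h₂]
  · simp [h]

/-- For a finite simple undirected graph `G = (V, E)` and an edge `e ∈ E`,
`|Aut(G)| · |AO_{G−e}({e})| = |Aut(G − e)| · |AO_G({e})|`, where `G − e = (V, E ∖ {e})`. -/
theorem aut_mul_orbit_eq_of_deleteEdge {V : Type*} [Fintype V]
    (G : SimpleGraph V) (e : Sym2 V) (he : e ∈ G.edgeSet) :
    (autSet G).ncard * (edgeSetOrbit (G.deleteEdges {e}) {e}).ncard =
      (autSet (G.deleteEdges {e})).ncard * (edgeSetOrbit G {e}).ncard := by
  have hstab : {σ ∈ autSet (G.deleteEdges {e}) | pairSetMap σ {e} = {e}} =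
      {σ ∈ autSet G | pairSetMap σ {e} = {e}} := by
    ext σ
    simp only [Set.mem_ofPred_eq, pairSetMap, Set.image_singleton, Set.singleton_eq_singleton_iff]
    exact and_congr_left (mem_autSet_deleteEdges_iff he)
  rw [← ncard_stabilizer_mul_ncard_edgeSetOrbit G {e},
    ← ncard_stabilizer_mul_ncard_edgeSetOrbit (G.deleteEdges {e}) {e}, hstab]
  ring
end

section
/- Let G = (V, E) be a finite simple undirected graph, let E' ⊆ E, and let F' be an edge set on V such that the graph (V, F') is isomorphic to G − E' = (V, E ∖ E'). Then the number of sets s of unordered pairs of distinct vertices with s ∩ F' = ∅ for which there exists an isomorphism ψ from G to (V, F' ∪ s) with ψ(E') = s equals |AO_{G−E'}(E')|. -/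
theorem pairSetMap_mul {V : Type*} (σ τ : Equiv.Perm V) (S : Set (Sym2 V)) :
    pairSetMap (σ * τ) S = pairSetMap σ (pairSetMap τ S) := by
  simp only [pairSetMap, Set.image_image, Sym2.map_map, Equiv.Perm.coe_mul]

theorem pairSetMap_one {V : Type*} (S : Set (Sym2 V)) : pairSetMap 1 S = S := by
  simp [pairSetMap]

theorem pairSetMap_injective {V : Type*} (σ : Equiv.Perm V) :
    Function.Injective (pairSetMap σ) :=
  (Sym2.map.injective σ.injective).image_injective

theorem pairSetMap_inv_apply {V : Type*} (σ : Equiv.Perm V) (S : Set (Sym2 V)) :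
    pairSetMap σ⁻¹ (pairSetMap σ S) = S := by
  rw [← pairSetMap_mul, inv_mul_cancel, pairSetMap_one]

theorem pairSetMap_sdiff {V : Type*} (σ : Equiv.Perm V) (S T : Set (Sym2 V)) :
    pairSetMap σ (S \ T) = pairSetMap σ S \ pairSetMap σ T :=
  Set.image_sdiff (Sym2.map.injective σ.injective) S T

theorem map_mem_pairSetMap {V : Type*} (σ : Equiv.Perm V) (S : Set (Sym2 V)) (e : Sym2 V) :
    Sym2.map σ e ∈ pairSetMap σ S ↔ e ∈ S :=
  (Sym2.map.injective σ.injective).mem_set_image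

theorem mem_autSet_iff_pairSetMap_edgeSet {V : Type*} (H : SimpleGraph V) (σ : Equiv.Perm V) :
    σ ∈ autSet H ↔ pairSetMap σ H.edgeSet = H.edgeSet := by
  constructor
  · intro h
    ext e
    obtain ⟨e, rfl⟩ : ∃ d, Sym2.map σ d = e :=
      ⟨Sym2.map σ.symm e, by simp [Sym2.map_map]⟩
    rw [map_mem_pairSetMap]
    induction e with
    | _ a b => exact h a b
  · intro h a b
    have := map_mem_pairSetMap σ H.edgeSet s(a, b)
    rw [h] at this
    exact this.symm

/-- Let `G = (V, E)` be a finite simple graph, `E' ⊆ E`, and `F'` an edge set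
on `V` with `(V, F')` isomorphic to `G − E' = (V, E ∖ E')`. Then the number of sets `s` of
unordered pairs of distinct vertices with `s ∩ F' = ∅` for which there exists an isomorphism
`ψ` from `G` to `(V, F' ∪ s)` with `ψ(E') = s` equals `|AO_{G−E'}(E')|`. -/
theorem card_completions_eq_orbit_card {V : Type*} [Fintype V]
    (G : SimpleGraph V) (E' : Set (Sym2 V)) (hsub : E' ⊆ G.edgeSet)
    (F' : Set (Sym2 V)) (hiso : isIsoEdgeSet (G.deleteEdges E') F') :
    {s : Set (Sym2 V) | (∀ e ∈ s, ¬ e.IsDiag) ∧ s ∩ F' = ∅ ∧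
        ∃ ψ : Equiv.Perm V, pairSetMap ψ G.edgeSet = F' ∪ s ∧ pairSetMap ψ E' = s}.ncard =
      (edgeSetOrbit (G.deleteEdges E') E').ncard := by
  obtain ⟨τ, hτ⟩ := hiso
  rw [SimpleGraph.edgeSet_deleteEdges] at hτ
  rw [← Set.ncard_image_of_injective (edgeSetOrbit _ E') (pairSetMap_injective τ)]
  congr 1
  ext s
  constructor
  · rintro ⟨-, hdisj, ψ, hψ, hψs⟩
    refine ⟨pairSetMap (τ⁻¹ * ψ) E', ⟨τ⁻¹ * ψ, ?_, rfl⟩, ?_⟩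
    · have hF : pairSetMap ψ (G.edgeSet \ E') = F' := by
        rw [pairSetMap_sdiff, hψ, hψs, Set.union_sdiff_right]
        exact (Set.disjoint_iff_inter_eq_empty.mpr hdisj).symm.sdiff_eq_left
      rw [mem_autSet_iff_pairSetMap_edgeSet, SimpleGraph.edgeSet_deleteEdges, pairSetMap_mul, hF,
        ← hτ, pairSetMap_inv_apply]
    · rw [← pairSetMap_mul, mul_inv_cancel_left, hψs]
  · rintro ⟨_, ⟨σ, hσ, rfl⟩, rfl⟩
    rw [mem_autSet_iff_pairSetMap_edgeSet, SimpleGraph.edgeSet_deleteEdges] at hσ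
    have hF : pairSetMap (τ * σ) (G.edgeSet \ E') = F' := by
      rw [pairSetMap_mul, hσ, hτ]
    rw [← pairSetMap_mul]
    refine ⟨?_, ?_, τ * σ, ?_, rfl⟩
    · rintro _ ⟨e, he, rfl⟩
      rw [Sym2.isDiag_map (τ * σ).injective]
      exact G.not_isDiag_of_mem_edgeSet (hsub he)
    · rw [← hF, pairSetMap_sdiff, Set.inter_sdiff_self]
    · rw [← hF]
      unfold pairSetMap
      rw [← Set.image_union, Set.sdiff_union_of_subset hsub]
end
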